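/- For every α ∈ (0, 1/2) and all real parameters c, d, there exist ρ₀ > 0 and a solution (H, A, Z) of the CSS system on (0, ρ₀), real-analytic on [0, ρ₀) and depending analytically on (c, d), with the expansions H(ρ) = −π/2 + cρ + O(ρ³), A(ρ) = 1 − αc²ρ² + O(ρ⁴), Z(ρ) = dρ + O(ρ³) as ρ → 0⁺. -/

import Mathlib

open Real Filter Set Topology Asymptotics

noncomputable section

open MeasureTheory in
theorem continuous_dilation_integral (m : ℕ) (f : C(unitInterval, ℝ)) :
    Continuous fun s : unitInterval => ∫ t : unitInterval, (t : ℝ) ^ m * f (t * s) := by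
  have h : Continuous (Function.uncurry fun s t : unitInterval => (t : ℝ) ^ m * f (t * s)) := by
    unfold Function.uncurry
    fun_prop
  have h2 := continuous_parametric_integral_of_continuous (μ := volume) h isCompact_univ
  simpa only [Measure.restrict_univ] using h2

open MeasureTheory in
theorem integrable_dilation (m : ℕ) (f : C(unitInterval, ℝ)) (s : unitInterval) :
    Integrable fun t : unitInterval => (t : ℝ) ^ m * f (t * s) :=
  (show Continuous fun t : unitInterval => (t : ℝ) ^ m * f (t * s) by
    fun_prop).integrable_of_hasCompactSupport (HasCompactSupport.of_compactSpace _)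

open MeasureTheory in
/-- The weighted dilation average `f ↦ (s ↦ ∫₀¹ tᵐ f(ts) dt)` on `C([0,1], ℝ)`, which inverts
the singular operator `s d/ds + (m + 1)`. -/
def dilationAverage (m : ℕ) : C(unitInterval, ℝ) →L[ℝ] C(unitInterval, ℝ) :=
  LinearMap.mkContinuous
    { toFun := fun f => ⟨_, continuous_dilation_integral m f⟩
      map_add' := fun f g => by
        ext s
        simp only [ContinuousMap.coe_mk, ContinuousMap.add_apply, mul_add]
        exact integral_add (integrable_dilation m f s) (integrable_dilation m g s)
      map_smul' := fun r f => by
        ext s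
        simp only [ContinuousMap.coe_mk, ContinuousMap.smul_apply, smul_eq_mul,
          RingHom.id_apply, mul_left_comm _ r]
        exact integral_const_mul r _ }
    1 fun f => by
      rw [one_mul, ContinuousMap.norm_le _ (norm_nonneg f)]
      intro s
      refine (norm_integral_le_of_norm_le_const (C := ‖f‖) (.of_forall fun t => ?_)).trans
        (by simp)
      rw [norm_mul]
      refine (mul_le_of_le_one_left (norm_nonneg _) ?_).trans (f.norm_coe_le_norm _)
      rw [norm_pow, Real.norm_of_nonneg t.2.1]
      exact pow_le_one₀ t.2.1 t.2.2

open MeasureTheory in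
theorem dilationAverage_apply (m : ℕ) (f : C(unitInterval, ℝ)) (s : unitInterval) :
    dilationAverage m f s = ∫ t : unitInterval, (t : ℝ) ^ m * f (t * s) :=
  rfl

/-- The dilation `f ↦ f(l ·)` of a continuous function on `[0,1]`. -/
def dilate (l : unitInterval) (f : C(unitInterval, ℝ)) : C(unitInterval, ℝ) :=
  f.comp ⟨fun s => l * s, by fun_prop⟩

@[simp]
theorem dilate_apply (l s : unitInterval) (f : C(unitInterval, ℝ)) :
    dilate l f s = f (l * s) :=
  rfl

theorem norm_dilate_le (l : unitInterval) (f : C(unitInterval, ℝ)) : ‖dilate l f‖ ≤ ‖f‖ :=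
  (ContinuousMap.norm_le _ (norm_nonneg f)).2 fun s => f.norm_coe_le_norm (l * s)

theorem dilationAverage_dilate (m : ℕ) (l : unitInterval) (f : C(unitInterval, ℝ)) :
    dilationAverage m (dilate l f) = dilate l (dilationAverage m f) := by
  ext s
  simp only [dilate_apply, dilationAverage_apply, mul_left_comm l]

theorem dilationAverage_apply_eq_intervalIntegral (m : ℕ) (f : C(unitInterval, ℝ))
    (s : unitInterval) :
    dilationAverage m f s = ∫ t in (0 : ℝ)..1, t ^ m * IccExtend zero_le_one f (s * t) := by
  rw [dilationAverage_apply, intervalIntegral.integral_of_le zero_le_one,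
    ← MeasureTheory.integral_Icc_eq_integral_Ioc,
    ← MeasureTheory.integral_subtype measurableSet_Icc]
  refine MeasureTheory.integral_congr_ae (.of_forall fun t => ?_)
  have ht : (s : ℝ) * t = ((t * s : unitInterval) : ℝ) := mul_comm _ _
  simp only [ht, IccExtend_val]

theorem pow_mul_dilationAverage (m : ℕ) (f : C(unitInterval, ℝ)) (s : unitInterval) :
    (s : ℝ) ^ (m + 1) * dilationAverage m f s
      = ∫ x in (0 : ℝ)..s, x ^ m * IccExtend zero_le_one f x := by
  have h := intervalIntegral.smul_integral_comp_mul_left (a := 0) (b := 1)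
    (fun x : ℝ => x ^ m * IccExtend zero_le_one f x) (s : ℝ)
  rw [mul_zero, mul_one, smul_eq_mul] at h
  rw [dilationAverage_apply_eq_intervalIntegral, ← h, pow_succ', mul_assoc,
    ← intervalIntegral.integral_const_mul]
  simp only [mul_pow, mul_assoc]

theorem hasDerivAt_dilationAverage (m : ℕ) (f : C(unitInterval, ℝ)) {s : ℝ}
    (hs : s ∈ Ioo (0 : ℝ) 1) :
    HasDerivAt (IccExtend zero_le_one (dilationAverage m f))
      ((IccExtend zero_le_one f s
        - (m + 1) * IccExtend zero_le_one (dilationAverage m f) s) / s) s := by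
  have hcont : Continuous fun x : ℝ => x ^ m * IccExtend zero_le_one f x :=
    (continuous_id.pow m).mul (f.continuous.Icc_extend' (h := zero_le_one))
  have key {x : ℝ} (hx : x ∈ Ioo (0 : ℝ) 1) :
      x ^ (m + 1) * IccExtend zero_le_one (dilationAverage m f) x
        = ∫ y in (0 : ℝ)..x, y ^ m * IccExtend zero_le_one f y := by
    rw [IccExtend_of_mem _ _ (Ioo_subset_Icc_self hx)]
    exact pow_mul_dilationAverage m f ⟨x, _⟩
  have hs0 : s ≠ 0 := hs.1.ne'
  have hI : HasDerivAt (fun x : ℝ => ∫ y in (0 : ℝ)..x, y ^ m * IccExtend zero_le_one f y)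
      (s ^ m * IccExtend zero_le_one f s) s :=
    intervalIntegral.integral_hasDerivAt_right (hcont.intervalIntegrable _ _)
      (hcont.stronglyMeasurableAtFilter _ _) hcont.continuousAt
  have hq := hI.div (hasDerivAt_pow (m + 1) s) (pow_ne_zero _ hs0)
  refine (hq.congr_of_eventuallyEq ?_).congr_deriv ?_
  · filter_upwards [isOpen_Ioo.mem_nhds hs] with x hx
    rw [Pi.div_apply, ← key hx, mul_div_cancel_left₀ _ (pow_ne_zero _ hx.1.ne')]
  · rw [← key hs]
    push_cast [Nat.add_sub_cancel]
    field_simp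
    ring

/-- A function vanishing at `0` together with its derivative. -/
def FlatAtZero {E F : Type*} [NormedAddCommGroup E] [NormedSpace ℝ E]
    [NormedAddCommGroup F] [NormedSpace ℝ F] (f : E → F) : Prop :=
  f 0 = 0 ∧ HasFDerivAt f (0 : E →L[ℝ] F) 0

namespace FlatAtZero

variable {E F G R : Type*} [NormedAddCommGroup E] [NormedSpace ℝ E]
  [NormedAddCommGroup F] [NormedSpace ℝ F] [NormedAddCommGroup G] [NormedSpace ℝ G]
  [NormedCommRing R] [NormedAlgebra ℝ R]

theorem add {f g : E → F} (hf : FlatAtZero f) (hg : FlatAtZero g) :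
    FlatAtZero fun x => f x + g x :=
  ⟨by simp [hf.1, hg.1], by simpa using hf.2.fun_add hg.2⟩

theorem neg {f : E → F} (hf : FlatAtZero f) : FlatAtZero fun x => -f x :=
  ⟨by simp [hf.1], by simpa using hf.2.fun_neg⟩

theorem sub {f g : E → F} (hf : FlatAtZero f) (hg : FlatAtZero g) :
    FlatAtZero fun x => f x - g x := by
  simpa only [sub_eq_add_neg] using hf.add hg.neg

theorem clm {f : E → F} (L : F →L[ℝ] G) (hf : FlatAtZero f) : FlatAtZero fun x => L (f x) :=
  ⟨by simp [hf.1], (L.hasFDerivAt.comp (0 : E) hf.2).congr_fderiv (by simp)⟩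

theorem const_smul {f : E → F} (c : ℝ) (hf : FlatAtZero f) : FlatAtZero fun x => c • f x :=
  hf.clm (c • ContinuousLinearMap.id ℝ F)

theorem prodMk {f : E → F} {g : E → G} (hf : FlatAtZero f) (hg : FlatAtZero g) :
    FlatAtZero fun x => (f x, g x) :=
  ⟨by simp [hf.1, hg.1], (hf.2.prodMk hg.2).congr_fderiv (by ext <;> simp)⟩

theorem of_mul {f g : E → R} (hf : DifferentiableAt ℝ f 0) (hf0 : f 0 = 0)
    (hg : DifferentiableAt ℝ g 0) (hg0 : g 0 = 0) : FlatAtZero fun x => f x * g x :=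
  ⟨by simp [hf0], (hf.hasFDerivAt.fun_mul hg.hasFDerivAt).congr_fderiv (by ext; simp [hf0, hg0])⟩

theorem differentiableAt {f : E → F} (hf : FlatAtZero f) : DifferentiableAt ℝ f 0 :=
  hf.2.differentiableAt

theorem mul_right {f g : E → R} (hf : FlatAtZero f) (hg : DifferentiableAt ℝ g 0) :
    FlatAtZero fun x => f x * g x :=
  ⟨by simp [hf.1], (hf.2.fun_mul hg.hasFDerivAt).congr_fderiv (by ext; simp [hf.1])⟩

theorem mul_left {f g : E → R} (hf : DifferentiableAt ℝ f 0) (hg : FlatAtZero g) :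
    FlatAtZero fun x => f x * g x := by
  simpa only [mul_comm] using hg.mul_right hf

end FlatAtZero

/-- Tuples `(P, Q, W, B, M)` of rescaled unknowns: with `s` the radial variable,
`tan (H + π/2) = s (P + Q)`, `ρ H' = s (P - 2 Q)`, `Z = s W`, `A = 1 + s² B` and
`1 / (A (1 - Z²) (1 + tan² (H + π/2))) = 1 + s² M`. -/
abbrev Profiles : Type :=
  C(unitInterval, ℝ) × C(unitInterval, ℝ) × C(unitInterval, ℝ) × C(unitInterval, ℝ) ×
    C(unitInterval, ℝ)

/-- The function `s ↦ s²` on `[0,1]`. -/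
def radiusSq : C(unitInterval, ℝ) :=
  ⟨fun s => (s : ℝ) ^ 2, by fun_prop⟩

@[simp]
theorem radiusSq_apply (s : unitInterval) : radiusSq s = (s : ℝ) ^ 2 :=
  rfl

namespace Profiles

def tangent (X : Profiles) : C(unitInterval, ℝ) := X.1 + X.2.1

def slope (X : Profiles) : C(unitInterval, ℝ) := X.1 - (2 : ℝ) • X.2.1

def shift (X : Profiles) : C(unitInterval, ℝ) := X.2.2.1

def mass (X : Profiles) : C(unitInterval, ℝ) := X.2.2.2.1

def weight (X : Profiles) : C(unitInterval, ℝ) := X.2.2.2.2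

def massSource (α : ℝ) (X : Profiles) : C(unitInterval, ℝ) :=
  (-2 * α) • (X.slope * X.slope * (1 + radiusSq * X.mass))

def massUpdate (α : ℝ) (X : Profiles) : C(unitInterval, ℝ) :=
  dilationAverage 1 (X.massSource α)

def shiftSource (α : ℝ) (X : Profiles) : C(unitInterval, ℝ) :=
  α • (X.slope * X.slope * (X.shift * (1 - radiusSq * (X.shift * X.shift))))

/-- The nonlinear part of the equation for `ρ H'`, divided by `s³`. -/
def force (α : ℝ) (X : Profiles) : C(unitInterval, ℝ) :=
  α • (X.slope * X.slope * (X.slope * (1 + radiusSq * (X.shift * X.shift)))) +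
    (2 : ℝ) • (X.tangent * X.weight)

def bend (X : Profiles) : C(unitInterval, ℝ) := X.slope * X.tangent * X.tangent

/-- The profile `J` with `(1 + s² T²) (1 + s² B) (1 - s² W²) = 1 + s² J`. -/
def defect (α : ℝ) (X : Profiles) : C(unitInterval, ℝ) :=
  X.tangent * X.tangent + X.massUpdate α - X.shift * X.shift +
    (radiusSq * (X.tangent * X.tangent * X.massUpdate α
      - X.tangent * X.tangent * (X.shift * X.shift) - X.massUpdate α * (X.shift * X.shift))
    - radiusSq * radiusSq * (X.tangent * X.tangent * X.massUpdate α * (X.shift * X.shift)))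

/-- The nonlinearity of the fixed-point form of the rescaled system. -/
def update (α : ℝ) (X : Profiles) : Profiles :=
  (radiusSq * dilationAverage 1 ((1 / 3 : ℝ) • ((2 : ℝ) • X.bend + X.force α)),
    radiusSq * dilationAverage 4 ((1 / 3 : ℝ) • (X.bend - X.force α)),
    radiusSq * dilationAverage 1 (X.shiftSource α),
    X.massUpdate α,
    -(X.defect α * (1 + radiusSq * X.weight)))

theorem contDiff_update (α : ℝ) : ContDiff ℝ ⊤ (update α) := by
  unfold update defect massUpdate massSource shiftSource force bend tangent slope shift mass weight
  fun_prop

theorem flatAtZero_update (α : ℝ) : FlatAtZero (update α) := by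
  have dK : DifferentiableAt ℝ slope 0 := by unfold slope; fun_prop
  have dT : DifferentiableAt ℝ tangent 0 := by unfold tangent; fun_prop
  have dW : DifferentiableAt ℝ shift 0 := by unfold shift; fun_prop
  have dB : DifferentiableAt ℝ mass 0 := by unfold mass; fun_prop
  have dM : DifferentiableAt ℝ weight 0 := by unfold weight; fun_prop
  have zK : slope 0 = 0 := by simp [slope]
  have zT : tangent 0 = 0 := by simp [tangent]
  have zW : shift 0 = 0 := rfl
  have zM : weight 0 = 0 := rfl
  have KK := FlatAtZero.of_mul dK zK dK zK
  have TT := FlatAtZero.of_mul dT zT dT zT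
  have WW := FlatAtZero.of_mul dW zW dW zW
  have dWW := WW.differentiableAt
  have hb : FlatAtZero (massUpdate α) :=
    ((KK.mul_right (by fun_prop)).const_smul _).clm _
  have hbend : FlatAtZero bend := (FlatAtZero.of_mul dK zK dT zT).mul_right dT
  have hforce : FlatAtZero (force α) :=
    ((KK.mul_right (by fun_prop)).const_smul _).add
      ((FlatAtZero.of_mul dT zT dM zM).const_smul _)
  have hshift : FlatAtZero (shiftSource α) := (KK.mul_right (by fun_prop)).const_smul _
  have hdefect : FlatAtZero (defect α) :=
    ((TT.add hb).sub WW).add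
      ((((TT.mul_right hb.differentiableAt).sub (TT.mul_right dWW)).sub
        (hb.mul_right dWW)).mul_left (differentiableAt_const _) |>.sub
        (((TT.mul_right hb.differentiableAt).mul_right dWW).mul_left (differentiableAt_const _)))
  have const : DifferentiableAt ℝ (fun _ : Profiles => radiusSq) 0 := differentiableAt_const _
  exact (((((hbend.const_smul _).add hforce).const_smul _).clm _).mul_left const).prodMk <|
    ((((hbend.sub hforce).const_smul _).clm _).mul_left const).prodMk <|
    ((hshift.clm _).mul_left const).prodMk <| hb.prodMk
    (hdefect.mul_right (by fun_prop)).neg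

/-- The linear part of the profiles with parameters `v = (c, d)`. -/
def base (v : ℝ × ℝ) : Profiles :=
  (algebraMap ℝ _ v.1, 0, algebraMap ℝ _ v.2, 0, 0)

/-- The rescaling of profiles induced by the dilation `s ↦ l s`. -/
def rescale (l : unitInterval) (X : Profiles) : Profiles :=
  ((l : ℝ) • dilate l X.1, (l : ℝ) • dilate l X.2.1, (l : ℝ) • dilate l X.2.2.1,
    (l : ℝ) ^ 2 • dilate l X.2.2.2.1, (l : ℝ) ^ 2 • dilate l X.2.2.2.2)

theorem norm_rescale_le (l : unitInterval) (X : Profiles) : ‖rescale l X‖ ≤ ‖X‖ := by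
  have h {r : ℝ} (hr0 : 0 ≤ r) (hr1 : r ≤ 1) (f : C(unitInterval, ℝ)) :
      ‖r • dilate l f‖ ≤ ‖f‖ := by
    rw [norm_smul, Real.norm_of_nonneg hr0]
    exact (mul_le_of_le_one_left (norm_nonneg _) hr1).trans (norm_dilate_le l f)
  have h2 : (l : ℝ) ^ 2 ≤ 1 := pow_le_one₀ l.2.1 l.2.2
  exact max_le_max (h l.2.1 l.2.2 _) <| max_le_max (h l.2.1 l.2.2 _) <|
    max_le_max (h l.2.1 l.2.2 _) <|
    max_le_max (h (sq_nonneg _) h2 _) (h (sq_nonneg _) h2 _)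

theorem dilationAverage_eq_of_homogeneous {m : ℕ} {l : unitInterval} {r : ℝ}
    {f g : C(unitInterval, ℝ)} (h : g = r • dilate l f) (s : unitInterval) :
    dilationAverage m g s = r * dilationAverage m f (l * s) := by
  rw [h, map_smul, dilationAverage_dilate, ContinuousMap.smul_apply, dilate_apply, smul_eq_mul]

theorem update_rescale (α : ℝ) (l : unitInterval) (X : Profiles) :
    update α (rescale l X) = rescale l (update α X) := by
  have coe_mul (s : unitInterval) : ((l * s : unitInterval) : ℝ) = l * s := rfl
  have hbend : bend (rescale l X) = (l : ℝ) ^ 3 • dilate l X.bend := by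
    ext s
    simp [bend, slope, tangent, rescale]
    ring
  have hforce : force α (rescale l X) = (l : ℝ) ^ 3 • dilate l (X.force α) := by
    ext s
    simp [force, slope, tangent, shift, weight, rescale, coe_mul]
    ring
  have hshift : shiftSource α (rescale l X) = (l : ℝ) ^ 3 • dilate l (X.shiftSource α) := by
    ext s
    simp [shiftSource, slope, shift, rescale, coe_mul]
    ring
  have hmass : massSource α (rescale l X) = (l : ℝ) ^ 2 • dilate l (X.massSource α) := by
    ext s
    simp [massSource, slope, mass, rescale, coe_mul]
    ring
  have hb (s : unitInterval) :
      massUpdate α (rescale l X) s = (l : ℝ) ^ 2 * X.massUpdate α (l * s) :=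
    dilationAverage_eq_of_homogeneous hmass s
  refine Prod.ext ?_ (Prod.ext ?_ (Prod.ext ?_ (Prod.ext ?_ ?_)))
  · ext s
    have := dilationAverage_eq_of_homogeneous (m := 1) (l := l) (r := (l : ℝ) ^ 3)
      (f := (1 / 3 : ℝ) • ((2 : ℝ) • X.bend + X.force α))
      (g := (1 / 3 : ℝ) • ((2 : ℝ) • bend (rescale l X) + force α (rescale l X)))
      (by ext s; simp [hbend, hforce]; ring) s
    simp only [update, rescale, ContinuousMap.mul_apply, ContinuousMap.smul_apply, dilate_apply,
      radiusSq_apply, coe_mul, smul_eq_mul] at this ⊢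
    rw [this]
    ring
  · ext s
    have := dilationAverage_eq_of_homogeneous (m := 4) (l := l) (r := (l : ℝ) ^ 3)
      (f := (1 / 3 : ℝ) • (X.bend - X.force α))
      (g := (1 / 3 : ℝ) • (bend (rescale l X) - force α (rescale l X)))
      (by ext s; simp [hbend, hforce]; ring) s
    simp only [update, rescale, ContinuousMap.mul_apply, ContinuousMap.smul_apply, dilate_apply,
      radiusSq_apply, coe_mul, smul_eq_mul] at this ⊢
    rw [this]
    ring
  · ext s
    have := dilationAverage_eq_of_homogeneous (m := 1) hshift s
    simp only [update, rescale, ContinuousMap.mul_apply, ContinuousMap.smul_apply, dilate_apply,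
      radiusSq_apply, coe_mul, smul_eq_mul] at this ⊢
    rw [this]
    ring
  · ext s
    exact hb s
  · ext s
    have hT : tangent (rescale l X) s = l * X.tangent (l * s) := by
      simp [tangent, rescale, mul_add]
    have hW : shift (rescale l X) s = l * X.shift (l * s) := rfl
    have hM : weight (rescale l X) s = (l : ℝ) ^ 2 * X.weight (l * s) := rfl
    change (update α (rescale l X)).2.2.2.2 s = (l : ℝ) ^ 2 * (update α X).2.2.2.2 (l * s)
    simp [update, defect, hT, hW, hM, hb, coe_mul]
    ring

theorem base_smul (l : unitInterval) (v : ℝ × ℝ) :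
    base ((l : ℝ) • v) = rescale l (base v) := by
  refine Prod.ext ?_ (Prod.ext ?_ (Prod.ext ?_ (Prod.ext ?_ ?_))) <;> ext s <;>
    simp [base, rescale]

theorem rescale_sub (l : unitInterval) (X Y : Profiles) :
    rescale l (X - Y) = rescale l X - rescale l Y := by
  refine Prod.ext ?_ (Prod.ext ?_ (Prod.ext ?_ (Prod.ext ?_ ?_))) <;> ext s <;>
    simp [rescale, mul_sub]

theorem contDiff_base {n : WithTop ℕ∞} : ContDiff ℝ n base := by
  unfold base
  simp only [Algebra.algebraMap_eq_smul_one]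
  fun_prop

/-- An analytic, dilation-equivariant family of small solutions of the fixed-point equation. -/
theorem exists_analytic_family (α : ℝ) : ∃ (Ψ : ℝ × ℝ → Profiles) (ε : ℝ), 0 < ε ∧
    ∀ v, ‖v‖ < ε → AnalyticAt ℝ Ψ v ∧ Ψ v = base v + update α (Ψ v) ∧
      ∀ l : unitInterval, Ψ ((l : ℝ) • v) = rescale l (Ψ v) := by
  set G : Profiles → Profiles := fun X => X - update α X with hG
  have hflat := flatAtZero_update α
  have hG0 : G 0 = 0 := by simp [hG, hflat.1]
  have hGdiff : ContDiffAt ℝ ⊤ G 0 := (contDiff_id.sub (contDiff_update α)).contDiffAt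
  have hGderiv :
      HasFDerivAt G (ContinuousLinearEquiv.refl ℝ Profiles : Profiles →L[ℝ] Profiles) 0 := by
    have := (hasFDerivAt_id (𝕜 := ℝ) (0 : Profiles)).fun_sub hflat.2
    rw [sub_zero] at this
    exact this
  set e := hGdiff.toOpenPartialHomeomorph G hGderiv (by simp)
  have hsource : (0 : Profiles) ∈ e.source := hGdiff.mem_toOpenPartialHomeomorph_source hGderiv _
  have htarget : (0 : Profiles) ∈ e.target := by
    have := hGdiff.image_mem_toOpenPartialHomeomorph_target hGderiv (by simp)
    rwa [hG0] at this
  have hsymm0 : e.symm 0 = 0 := by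
    have := e.left_inv hsource
    rwa [show e 0 = 0 from hG0] at this
  have hsymm : ContDiffAt ℝ ⊤ e.symm 0 := by
    have := hGdiff.to_localInverse hGderiv (by simp)
    rwa [hG0] at this
  have hbase0 : base 0 = 0 := by simp [base]
  have hΨ : AnalyticAt ℝ (fun v => e.symm (base v)) 0 := by
    refine ContDiffAt.analyticAt (𝕜 := ℝ) ?_
    exact ContDiffAt.comp (0 : ℝ × ℝ) (by rwa [hbase0]) contDiff_base.contDiffAt
  obtain ⟨r, hr, hball⟩ := Metric.isOpen_iff.1 e.open_source 0 hsource
  have hsmall : ∀ᶠ v in 𝓝 (0 : ℝ × ℝ), ‖e.symm (base v)‖ < r := by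
    have := hΨ.continuousAt.norm
    refine this.eventually_lt_const ?_
    simpa [hbase0, hsymm0] using hr
  have hmem : ∀ᶠ v in 𝓝 (0 : ℝ × ℝ), base v ∈ e.target := by
    refine (contDiff_base (n := 0)).continuous.continuousAt.eventually_mem ?_
    rw [hbase0]
    exact e.open_target.mem_nhds htarget
  obtain ⟨ε, hε, h⟩ := Metric.eventually_nhds_iff.1
    (hΨ.eventually_analyticAt.and (hsmall.and hmem))
  refine ⟨fun v => e.symm (base v), ε, hε, fun v hv => ?_⟩
  obtain ⟨h1, h2, h3⟩ := h (y := v) (by simpa using hv)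
  have heq : G (e.symm (base v)) = base v := e.right_inv h3
  refine ⟨h1, ?_, fun l => ?_⟩
  · exact sub_eq_iff_eq_add.1 heq
  · have h4 : rescale l (e.symm (base v)) ∈ e.source :=
      hball (by simpa using (norm_rescale_le l _).trans_lt h2)
    have h5 : e (rescale l (e.symm (base v))) = base ((l : ℝ) • v) := by
      change G _ = _
      rw [base_smul]
      refine Eq.trans ?_ (congrArg (rescale l) heq)
      simp only [hG, update_rescale, rescale_sub]
    simp only
    rw [← h5, e.left_inv h4]

end Profiles

theorem dilationAverage_radiusSq_mul (m : ℕ) (f : C(unitInterval, ℝ)) :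
    dilationAverage m (radiusSq * f) = radiusSq * dilationAverage (m + 2) f := by
  ext s
  rw [ContinuousMap.mul_apply, radiusSq_apply, dilationAverage_apply, dilationAverage_apply,
    ← MeasureTheory.integral_const_mul]
  congr 1 with t
  rw [ContinuousMap.mul_apply, radiusSq_apply, show ((t * s : unitInterval) : ℝ) = t * s from rfl]
  ring

theorem dilationAverage_one_algebraMap (c : ℝ) :
    dilationAverage 1 (algebraMap ℝ _ c) = algebraMap ℝ C(unitInterval, ℝ) (c / 2) := by
  ext s
  rw [dilationAverage_apply_eq_intervalIntegral]
  simp [IccExtend_apply, integral_id]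
  ring

theorem hasDerivAt_iccExtend_of_eq {m : ℕ} {c : ℝ} {f g : C(unitInterval, ℝ)}
    (h : f = algebraMap ℝ _ c + radiusSq * dilationAverage m g) {s : ℝ} (hs : s ∈ Ioo (0 : ℝ) 1) :
    HasDerivAt (IccExtend zero_le_one f)
      (s * IccExtend zero_le_one g s + (1 - m) * (IccExtend zero_le_one f s - c) / s) s := by
  have hf {x : ℝ} (hx : x ∈ Ioo (0 : ℝ) 1) : IccExtend zero_le_one f x
      = c + x ^ 2 * IccExtend zero_le_one (dilationAverage m g) x := by
    simp only [IccExtend_of_mem _ _ (Ioo_subset_Icc_self hx)]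
    rw [h]
    simp
  have hs0 : s ≠ 0 := hs.1.ne'
  have hd := ((hasDerivAt_pow 2 s).mul (hasDerivAt_dilationAverage m g hs)).const_add c
  refine (hd.congr_of_eventuallyEq ?_).congr_deriv ?_
  · filter_upwards [isOpen_Ioo.mem_nhds hs] with x hx using hf hx
  · rw [hf hs]
    push_cast
    field_simp
    ring

theorem abs_sub_le_of_eq {c : ℝ} {f h : C(unitInterval, ℝ)}
    (hf : f = algebraMap ℝ _ c + radiusSq * h) (s : unitInterval) :
    |f s - c| ≤ ‖h‖ * (s : ℝ) ^ 2 := by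
  have hfs : f s - c = h s * (s : ℝ) ^ 2 := by
    rw [hf]
    simp [mul_comm]
  rw [hfs, abs_mul, abs_of_nonneg (sq_nonneg (s : ℝ))]
  exact mul_le_mul_of_nonneg_right (h.norm_coe_le_norm s) (sq_nonneg _)

namespace Profiles

variable {α : ℝ} {v : ℝ × ℝ} {X : Profiles}

theorem mass_eq_of_fixed (hX : X = base v + update α X) : X.mass = X.massUpdate α := by
  have := congrArg mass hX
  rw [this]
  exact zero_add _

theorem exists_mass_eq (hX : X = base v + update α X) : ∃ h : C(unitInterval, ℝ),
    X.mass = algebraMap ℝ _ (-(α * v.1 ^ 2)) + radiusSq * h := by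
  obtain ⟨κ, hκ⟩ : ∃ κ, X.slope = algebraMap ℝ _ v.1 + radiusSq * κ := by
    refine ⟨dilationAverage 1 ((1 / 3 : ℝ) • ((2 : ℝ) • X.bend + X.force α))
      - (2 : ℝ) • dilationAverage 4 ((1 / 3 : ℝ) • (X.bend - X.force α)), ?_⟩
    have := congrArg slope hX
    rw [this]
    ext s
    simp [slope, base, update]
    ring
  refine ⟨dilationAverage 3 ((-2 * α) • ((2 * v.1) • κ + radiusSq * κ * κ
    + X.slope * X.slope * X.mass)), ?_⟩
  refine (mass_eq_of_fixed hX).trans ?_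
  rw [← dilationAverage_radiusSq_mul, massUpdate,
    show -(α * v.1 ^ 2) = (-2 * α * v.1 ^ 2) / 2 by ring, ← dilationAverage_one_algebraMap,
    ← map_add]
  congr 1
  ext s
  simp only [massSource, ContinuousMap.smul_apply, ContinuousMap.add_apply,
    ContinuousMap.mul_apply, hκ, ContinuousMap.one_apply, algebraMap_apply, mul_one,
    smul_eq_mul]
  ring

/-- The rescaled unknowns of a fixed point solve the first-order form of the CSS system. -/
theorem hasDerivAt_of_fixed (hX : X = base v + update α X) {s : ℝ} (hs : s ∈ Ioo (0 : ℝ) 1)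
    {τ k z a m : ℝ → ℝ}
    (hτ : ∀ l : unitInterval, τ l = l * X.tangent l) (hk : ∀ l : unitInterval, k l = l * X.slope l)
    (hz : ∀ l : unitInterval, z l = l * X.shift l)
    (ha : ∀ l : unitInterval, a l = 1 + (l : ℝ) ^ 2 * X.mass l)
    (hm : ∀ l : unitInterval, m l = 1 + (l : ℝ) ^ 2 * X.weight l) :
    HasDerivAt τ (k s * (1 + τ s ^ 2) / s) s ∧
    HasDerivAt k ((-k s + α * (1 + z s ^ 2) * k s ^ 3 + 2 * τ s * m s) / s) s ∧
    HasDerivAt z (z s * (1 + α * (1 - z s ^ 2) * k s ^ 2) / s) s ∧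
    HasDerivAt a (-2 * α * a s * k s ^ 2 / s) s ∧
    (1 + τ s ^ 2) * a s * (1 - z s ^ 2) * m s = 1 := by
  have hs0 : s ≠ 0 := hs.1.ne'
  have hmem : Icc (0 : ℝ) 1 ∈ 𝓝 s := Icc_mem_nhds hs.1 hs.2
  let l : unitInterval := ⟨s, Ioo_subset_Icc_self hs⟩
  have ext_apply (f : C(unitInterval, ℝ)) : IccExtend zero_le_one f s = f l :=
    IccExtend_of_mem _ _ (Ioo_subset_Icc_self hs)
  have hP : HasDerivAt (IccExtend zero_le_one X.1) _ s :=
    hasDerivAt_iccExtend_of_eq (m := 1) (congrArg (·.1) hX) hs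
  have hQ : HasDerivAt (IccExtend zero_le_one X.2.1) _ s :=
    hasDerivAt_iccExtend_of_eq (m := 4) (c := 0)
      ((congrArg (·.2.1) hX).trans (by rw [map_zero]; rfl)) hs
  have hW : HasDerivAt (IccExtend zero_le_one X.shift) _ s :=
    hasDerivAt_iccExtend_of_eq (m := 1) (congrArg (·.2.2.1) hX) hs
  have hB := hasDerivAt_dilationAverage 1 (X.massSource α) hs
  rw [show dilationAverage 1 (X.massSource α) = X.mass from (mass_eq_of_fixed hX).symm] at hB
  have hM : X.weight l = -(X.defect α l * (1 + s ^ 2 * X.weight l)) := by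
    have := congrArg (fun Y : Profiles => Y.weight l) hX
    refine this.trans ?_
    change (0 + -(X.defect α * (1 + radiusSq * X.weight))) l = _
    simp [l]
  have eventually_eq {f g : ℝ → ℝ} (h : ∀ l : unitInterval, f l = g l) : f =ᶠ[𝓝 s] g := by
    filter_upwards [hmem] with x hx using h ⟨x, hx⟩
  have val_ext (f : C(unitInterval, ℝ)) (l : unitInterval) :
      IccExtend zero_le_one f l = f l := IccExtend_val _ _ _
  simp only [ext_apply] at hP hQ hW hB
  have hτs : τ s = s * (X.1 l + X.2.1 l) := hτ l
  have hks : k s = s * (X.1 l - 2 * X.2.1 l) := hk l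
  have hzs : z s = s * X.shift l := hz l
  have has : a s = 1 + s ^ 2 * X.mass l := ha l
  have hms : m s = 1 + s ^ 2 * X.weight l := hm l
  have hT : X.tangent l = X.1 l + X.2.1 l := rfl
  have hK : X.slope l = X.1 l - 2 * X.2.1 l := rfl
  have hl : (l : ℝ) = s := rfl
  refine ⟨?_, ?_, ?_, ?_, ?_⟩
  · refine (((hasDerivAt_id s).mul (hP.add hQ)).congr_of_eventuallyEq
      (eventually_eq fun l => ?_)).congr_deriv ?_
    · simp [hτ, val_ext, tangent]
    · rw [hτs, hks]
      simp [bend, force, hT, hK, hl, ext_apply]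
      field_simp
      ring
  · refine (((hasDerivAt_id s).mul (hP.sub (hQ.const_mul 2))).congr_of_eventuallyEq
      (eventually_eq fun l => ?_)).congr_deriv ?_
    · simp [hk, val_ext, slope]
    · rw [hτs, hks, hzs, hms]
      simp [bend, force, hT, hK, hl, ext_apply]
      field_simp
      ring
  · refine (((hasDerivAt_id s).mul hW).congr_of_eventuallyEq
      (eventually_eq fun l => ?_)).congr_deriv ?_
    · simp [hz, val_ext]
    · rw [hks, hzs]
      simp [shiftSource, hK, hl, ext_apply]
      field_simp
  · refine ((((hasDerivAt_pow 2 s).mul hB).const_add 1).congr_of_eventuallyEq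
      (eventually_eq fun l => ?_)).congr_deriv ?_
    · simp [ha, val_ext]
    · rw [hks, has]
      simp [massSource, hK, hl, ext_apply]
      field_simp
      ring
  · have hprod : (1 + (s * (X.1 l + X.2.1 l)) ^ 2) * (1 + s ^ 2 * X.mass l)
        * (1 - (s * X.shift l) ^ 2) = 1 + s ^ 2 * X.defect α l := by
      simp only [defect, ← mass_eq_of_fixed hX, ContinuousMap.add_apply, ContinuousMap.sub_apply,
        ContinuousMap.mul_apply, radiusSq_apply, hT, hl]
      ring
    rw [hτs, has, hzs, hms]
    rw [hprod]
    linear_combination s ^ 2 * hM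

end Profiles

/-- Analytic functions of the two variables `(cρ, dρ)` which solve the first-order form of the
CSS system along rays. -/
theorem exists_reduced_family (α : ℝ) : ∃ (τ k z a m : ℝ × ℝ → ℝ) (ε : ℝ), 0 < ε ∧
    ∀ v, ‖v‖ < ε → (AnalyticAt ℝ τ v ∧ AnalyticAt ℝ z v ∧ AnalyticAt ℝ a v) ∧
      (∀ s ∈ Ioo (0 : ℝ) 1,
        HasDerivAt (fun s : ℝ => τ (s • v)) (k (s • v) * (1 + τ (s • v) ^ 2) / s) s ∧
        HasDerivAt (fun s : ℝ => k (s • v))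
          ((-k (s • v) + α * (1 + z (s • v) ^ 2) * k (s • v) ^ 3
            + 2 * τ (s • v) * m (s • v)) / s) s ∧
        HasDerivAt (fun s : ℝ => z (s • v))
          (z (s • v) * (1 + α * (1 - z (s • v) ^ 2) * k (s • v) ^ 2) / s) s ∧
        HasDerivAt (fun s : ℝ => a (s • v)) (-2 * α * a (s • v) * k (s • v) ^ 2 / s) s ∧
        (1 + τ (s • v) ^ 2) * a (s • v) * (1 - z (s • v) ^ 2) * m (s • v) = 1) ∧
      ∃ C, ∀ s ∈ Ioo (0 : ℝ) 1,
        |τ (s • v) - s * v.1| ≤ C * s ^ 3 ∧ |z (s • v) - s * v.2| ≤ C * s ^ 3 ∧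
        |a (s • v) - (1 - α * (s * v.1) ^ 2)| ≤ C * s ^ 4 := by
  obtain ⟨Ψ, ε, hε, hΨ⟩ := Profiles.exists_analytic_family α
  refine ⟨fun v => (Ψ v).tangent 1, fun v => (Ψ v).slope 1, fun v => (Ψ v).shift 1,
    fun v => 1 + (Ψ v).mass 1, fun v => 1 + (Ψ v).weight 1, ε, hε, fun v hv => ?_⟩
  obtain ⟨hana, hfix, hdil⟩ := hΨ v hv
  have hτ (l : unitInterval) : (Ψ ((l : ℝ) • v)).tangent 1 = l * (Ψ v).tangent l := by
    simp [hdil, Profiles.tangent, Profiles.rescale, mul_add]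
  have hz (l : unitInterval) : (Ψ ((l : ℝ) • v)).shift 1 = l * (Ψ v).shift l := by
    simp [hdil, Profiles.shift, Profiles.rescale]
  have ha (l : unitInterval) : 1 + (Ψ ((l : ℝ) • v)).mass 1 = 1 + (l : ℝ) ^ 2 * (Ψ v).mass l := by
    simp [hdil, Profiles.mass, Profiles.rescale]
  have hk (l : unitInterval) : (Ψ ((l : ℝ) • v)).slope 1 = l * (Ψ v).slope l := by
    simp [hdil, Profiles.slope, Profiles.rescale]
    ring
  have hm (l : unitInterval) :
      1 + (Ψ ((l : ℝ) • v)).weight 1 = 1 + (l : ℝ) ^ 2 * (Ψ v).weight l := by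
    simp [hdil, Profiles.weight, Profiles.rescale]
  refine ⟨?_, fun s hs => ?_, ?_⟩
  · have h {f : Profiles → C(unitInterval, ℝ)} (hf : ContDiff ℝ ⊤ f) :
        AnalyticAt ℝ (fun v => f (Ψ v) 1) v := by
      have h1 : ContDiff ℝ ⊤ (fun X => f X 1) :=
        (ContinuousMap.evalCLM (M := ℝ) ℝ (1 : unitInterval)).contDiff.comp hf
      exact (h1.contDiffAt.analyticAt (x := Ψ v)).comp hana
    exact ⟨h (by unfold Profiles.tangent; fun_prop), h (by unfold Profiles.shift; fun_prop),
      analyticAt_const.add (h (by unfold Profiles.mass; fun_prop))⟩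
  · exact Profiles.hasDerivAt_of_fixed hfix hs (τ := fun s : ℝ => (Ψ (s • v)).tangent 1)
      (k := fun s : ℝ => (Ψ (s • v)).slope 1) (z := fun s : ℝ => (Ψ (s • v)).shift 1)
      (a := fun s : ℝ => 1 + (Ψ (s • v)).mass 1) (m := fun s : ℝ => 1 + (Ψ (s • v)).weight 1)
      hτ hk hz ha hm
  · obtain ⟨h, hh⟩ := Profiles.exists_mass_eq hfix
    have hP := abs_sub_le_of_eq (congrArg (·.1) hfix)
    have hQ := abs_sub_le_of_eq (c := 0)
      ((congrArg (·.2.1) hfix).trans (by rw [map_zero]; rfl))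
    have hW := abs_sub_le_of_eq (congrArg (·.2.2.1) hfix)
    have hB := abs_sub_le_of_eq hh
    set CP := ‖dilationAverage 1 ((1 / 3 : ℝ) • ((2 : ℝ) • (Ψ v).bend + (Ψ v).force α))‖
    set CQ := ‖dilationAverage 4 ((1 / 3 : ℝ) • ((Ψ v).bend - (Ψ v).force α))‖
    set CW := ‖dilationAverage 1 ((Ψ v).shiftSource α)‖
    have nP : 0 ≤ CP := norm_nonneg _
    have nQ : 0 ≤ CQ := norm_nonneg _
    have nW : 0 ≤ CW := norm_nonneg _
    have nB := norm_nonneg h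
    refine ⟨CP + CQ + CW + ‖h‖, fun s hs => ?_⟩
    have hs2 := Ioo_subset_Icc_self hs
    have hs0 := hs.1
    specialize hτ ⟨s, hs2⟩
    specialize hz ⟨s, hs2⟩
    specialize ha ⟨s, hs2⟩
    specialize hP ⟨s, hs2⟩
    specialize hQ ⟨s, hs2⟩
    specialize hW ⟨s, hs2⟩
    specialize hB ⟨s, hs2⟩
    simp only at hτ hz ha
    have mono {C D : ℝ} (hCD : C ≤ D) (n : ℕ) : C * s ^ n ≤ D * s ^ n :=
      mul_le_mul_of_nonneg_right hCD (pow_nonneg hs0.le n)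
    beta_reduce
    refine ⟨?_, ?_, ?_⟩
    · rw [hτ]
      change |s * ((Ψ v).1 _ + (Ψ v).2.1 _) - _| ≤ _
      rw [show ∀ p q : ℝ, s * (p + q) - s * v.1 = s * ((p - v.1) + (q - 0)) by intros; ring,
        abs_mul, abs_of_pos hs0]
      refine le_trans ?_ (mono (show CP + CQ ≤ _ by linarith) 3)
      calc s * _ ≤ s * (CP * s ^ 2 + CQ * s ^ 2) :=
            mul_le_mul_of_nonneg_left ((abs_add_le _ _).trans (add_le_add hP hQ)) hs0.le
        _ = _ := by ring
    · rw [hz, ← mul_sub, abs_mul, abs_of_pos hs0]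
      refine le_trans ?_ (mono (show CW ≤ _ by linarith) 3)
      calc s * _ ≤ s * (CW * s ^ 2) := mul_le_mul_of_nonneg_left hW hs0.le
        _ = _ := by ring
    · rw [ha, show ∀ b : ℝ, 1 + s ^ 2 * b - (1 - α * (s * v.1) ^ 2)
          = s ^ 2 * (b - -(α * v.1 ^ 2)) by intros; ring, abs_mul, abs_of_pos (pow_pos hs0 2)]
      refine le_trans ?_ (mono (show ‖h‖ ≤ _ by linarith) 4)
      calc s ^ 2 * _ ≤ s ^ 2 * (‖h‖ * s ^ 2) := mul_le_mul_of_nonneg_left hB (pow_nonneg hs0.le 2)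
        _ = _ := by ring

theorem isBigO_arctan_sub_id : (fun x : ℝ => arctan x - x) =O[𝓝 0] fun x => x ^ 3 := by
  refine IsBigO.of_bound 1 (Eventually.of_forall fun x => ?_)
  have hderiv (y : ℝ) : HasDerivAt (fun x => arctan x - x) (1 / (1 + y ^ 2) - 1) y :=
    (hasDerivAt_arctan y).sub (hasDerivAt_id y)
  have hbound (y : ℝ) (hy : y ∈ uIcc 0 x) : ‖1 / (1 + y ^ 2) - 1‖ ≤ x ^ 2 := by
    have hyx : y ^ 2 ≤ x ^ 2 := by
      rcases le_total 0 x with h | h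
      · rw [uIcc_of_le h] at hy
        nlinarith [hy.1, hy.2]
      · rw [uIcc_of_ge h] at hy
        nlinarith [hy.1, hy.2]
    have hpos : 0 < 1 + y ^ 2 := by positivity
    rw [show 1 / (1 + y ^ 2) - 1 = -(y ^ 2 / (1 + y ^ 2)) by field_simp; ring, norm_neg,
      norm_of_nonneg (by positivity)]
    exact (div_le_self (sq_nonneg y) (by nlinarith)).trans hyx
  have := (convex_uIcc 0 x).norm_image_sub_le_of_norm_hasDerivWithin_le
    (fun y _ => (hderiv y).hasDerivWithinAt) hbound left_mem_uIcc right_mem_uIcc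
  simpa [pow_succ, abs_mul] using this

theorem sin_two_mul_arctan_sub_pi_div_two (x : ℝ) :
    sin (2 * (-(π / 2) + arctan x)) = -(2 * x / (1 + x ^ 2)) := by
  have h : 0 < 1 + x ^ 2 := by positivity
  rw [show 2 * (-(π / 2) + arctan x) = 2 * arctan x - π by ring, sin_sub_pi, sin_two_mul,
    sin_arctan, cos_arctan]
  have := Real.sq_sqrt h.le
  field_simp
  rw [this]

/-- The second-order form of the system, recovered from its first-order form. -/
theorem css_of_reduced {α r ρ : ℝ} (hρ : ρ ∈ Ioo 0 r) {τ k z a m : ℝ → ℝ}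
    (h : ∀ ρ ∈ Ioo 0 r, HasDerivAt τ (k ρ * (1 + τ ρ ^ 2) / ρ) ρ ∧
      HasDerivAt k ((-k ρ + α * (1 + z ρ ^ 2) * k ρ ^ 3 + 2 * τ ρ * m ρ) / ρ) ρ ∧
      HasDerivAt z (z ρ * (1 + α * (1 - z ρ ^ 2) * k ρ ^ 2) / ρ) ρ ∧
      HasDerivAt a (-2 * α * a ρ * k ρ ^ 2 / ρ) ρ ∧
      (1 + τ ρ ^ 2) * a ρ * (1 - z ρ ^ 2) * m ρ = 1) {H : ℝ → ℝ}
    (hH : ∀ ρ, H ρ = -(π / 2) + arctan (τ ρ)) :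
    deriv (deriv H) ρ + (2 / ρ) * deriv H ρ - α * (1 + z ρ ^ 2) * ρ * deriv H ρ ^ 3
        + sin (2 * H ρ) / (a ρ * ρ ^ 2 * (1 - z ρ ^ 2)) = 0 ∧
      deriv a ρ = -2 * α * ρ * a ρ * deriv H ρ ^ 2 ∧
      ρ * deriv z ρ = z ρ * (1 + α * (1 - z ρ ^ 2) * ρ ^ 2 * deriv H ρ ^ 2) := by
  have hderiv (x : ℝ) (hx : x ∈ Ioo 0 r) : deriv H x = k x / x := by
    have hx0 : x ≠ 0 := hx.1.ne'
    have hpos : 1 + τ x ^ 2 ≠ 0 := by positivity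
    rw [funext hH, ((h x hx).1.arctan.const_add _).deriv]
    field_simp
  obtain ⟨-, hk, hz, ha, hm⟩ := h ρ hρ
  have hρ0 : ρ ≠ 0 := hρ.1.ne'
  have hderiv2 : deriv (deriv H) ρ = _ :=
    ((hk.div (hasDerivAt_id ρ) hρ0).congr_of_eventuallyEq
      (by filter_upwards [isOpen_Ioo.mem_nhds hρ] with x hx using hderiv x hx)).deriv
  have hpos : 1 + τ ρ ^ 2 ≠ 0 := by positivity
  have ha0 : a ρ ≠ 0 := by
    rintro h0
    simp [h0] at hm
  have hz0 : 1 - z ρ ^ 2 ≠ 0 := by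
    rintro h0
    simp [h0] at hm
  have hsin : sin (2 * H ρ) / (a ρ * ρ ^ 2 * (1 - z ρ ^ 2)) = -(2 * τ ρ * m ρ) / ρ ^ 2 := by
    rw [hH, sin_two_mul_arctan_sub_pi_div_two]
    field_simp
    linear_combination τ ρ * hm
  refine ⟨?_, ?_, ?_⟩
  · rw [hsin, hderiv2, hderiv ρ hρ]
    simp only [id]
    field_simp
    ring
  · rw [hderiv ρ hρ, ha.deriv]
    field_simp
  · rw [hderiv ρ hρ, hz.deriv]
    field_simp

/-- Proposition 13: local existence of a two-parameter family of solutions of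
the CSS system near the singular point `ρ = 0`, real-analytic on `[0, ρ₀)` and
depending analytically on the parameters `(c, d)`, with the expansions
`H = -π/2 + cρ + O(ρ³)`, `A = 1 - αc²ρ² + O(ρ⁴)`, `Z = dρ + O(ρ³)`. -/
theorem proposition13 (α : ℝ) (hα0 : 0 < α) (hα : α < 1 / 2) :
    ∃ (H A Z : ℝ → ℝ → ℝ → ℝ) (ρ₀ : ℝ → ℝ → ℝ),
      ∀ c d : ℝ,
        0 < ρ₀ c d ∧
        (∀ ρ ∈ Set.Ioo 0 (ρ₀ c d),
          deriv (deriv (H c d)) ρ + (2 / ρ) * deriv (H c d) ρ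
              - α * (1 + Z c d ρ ^ 2) * ρ * deriv (H c d) ρ ^ 3
              + Real.sin (2 * H c d ρ)
                  / (A c d ρ * ρ ^ 2 * (1 - Z c d ρ ^ 2)) = 0 ∧
          deriv (A c d) ρ = -2 * α * ρ * A c d ρ * deriv (H c d) ρ ^ 2 ∧
          ρ * deriv (Z c d) ρ
              = Z c d ρ * (1 + α * (1 - Z c d ρ ^ 2) * ρ ^ 2
                  * deriv (H c d) ρ ^ 2)) ∧
        (∀ ρ, 0 ≤ ρ → ρ < ρ₀ c d →
          AnalyticAt ℝ (fun p : ℝ × ℝ × ℝ => H p.1 p.2.1 p.2.2) (c, d, ρ) ∧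
          AnalyticAt ℝ (fun p : ℝ × ℝ × ℝ => A p.1 p.2.1 p.2.2) (c, d, ρ) ∧
          AnalyticAt ℝ (fun p : ℝ × ℝ × ℝ => Z p.1 p.2.1 p.2.2) (c, d, ρ)) ∧
        (fun ρ => H c d ρ - (-(π / 2) + c * ρ)) =O[𝓝[>] 0] (fun ρ => ρ ^ 3) ∧
        (fun ρ => A c d ρ - (1 - α * c ^ 2 * ρ ^ 2)) =O[𝓝[>] 0]
            (fun ρ => ρ ^ 4) ∧
        (fun ρ => Z c d ρ - d * ρ) =O[𝓝[>] 0] (fun ρ => ρ ^ 3) := by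
  obtain ⟨τ, k, z, a, m, ε, hε, hfam⟩ := exists_reduced_family α
  refine ⟨fun c d ρ => -(π / 2) + arctan (τ (ρ • (c, d))), fun c d ρ => a (ρ • (c, d)),
    fun c d ρ => z (ρ • (c, d)), fun c d => ε / (‖(c, d)‖ + 1), fun c d => ?_⟩
  beta_reduce
  set r := ε / (‖(c, d)‖ + 1)
  have hn : 0 < ‖(c, d)‖ + 1 := by positivity
  have hr : 0 < r := div_pos hε hn
  have hsmall {ρ : ℝ} (h0 : 0 ≤ ρ) (hρ : ρ ≤ r) : ‖ρ • (c, d)‖ < ε := by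
    rw [norm_smul, norm_of_nonneg h0]
    have h1 : ρ * (‖(c, d)‖ + 1) ≤ ε := (le_div_iff₀ hn).1 hρ
    rcases h0.eq_or_lt with rfl | h0
    · simpa using hε
    · linarith
  obtain ⟨-, hode, C, hC⟩ := hfam (r • (c, d)) (hsmall hr.le le_rfl)
  have hdiv {ρ : ℝ} (hρ : ρ ∈ Ioo 0 r) : ρ / r ∈ Ioo (0 : ℝ) 1 :=
    ⟨div_pos hρ.1 hr, (div_lt_one hr).2 hρ.2⟩
  have hray (ρ : ℝ) : (ρ / r) • r • (c, d) = ρ • (c, d) := by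
    rw [smul_smul, div_mul_cancel₀ _ hr.ne']
  have hIoo : Ioo 0 r ∈ 𝓝[>] (0 : ℝ) := Ioo_mem_nhdsGT hr
  refine ⟨hr, fun ρ hρ => ?_, fun ρ h0 hρ => ?_, ?_⟩
  · refine css_of_reduced (α := α) (a := fun ρ => a (ρ • (c, d))) (z := fun ρ => z (ρ • (c, d)))
      (τ := fun ρ => τ (ρ • (c, d))) (k := fun ρ => k (ρ • (c, d)))
      (m := fun ρ => m (ρ • (c, d)))
      (H := fun ρ => -(π / 2) + arctan (τ (ρ • (c, d)))) hρ (fun x hx => ?_) (fun _ => rfl)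
    have hpull {f : ℝ × ℝ → ℝ} {f' : ℝ}
        (hf : HasDerivAt (fun s : ℝ => f (s • r • (c, d))) (f' / (x / r)) (x / r)) :
        HasDerivAt (fun ρ : ℝ => f (ρ • (c, d))) (f' / x) x := by
      have hx0 : x ≠ 0 := hx.1.ne'
      have := hf.comp x ((hasDerivAt_id x).div_const r)
      refine (this.congr_of_eventuallyEq (Eventually.of_forall fun y => ?_)).congr_deriv ?_
      · simp only [Function.comp_apply, id, hray]
      · field_simp
    have hx' := hode (x / r) (hdiv hx)
    rw [hray] at hx'
    exact ⟨hpull hx'.1, hpull hx'.2.1, hpull hx'.2.2.1, hpull hx'.2.2.2.1, hx'.2.2.2.2⟩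
  · obtain ⟨⟨hτ, hz, ha⟩, -⟩ := hfam (ρ • (c, d)) (hsmall h0 hρ.le)
    have hray : AnalyticAt ℝ (fun p : ℝ × ℝ × ℝ => p.2.2 • (p.1, p.2.1)) (c, d, ρ) :=
      ContDiffAt.analyticAt (ContDiff.contDiffAt (by fun_prop))
    have harctan : AnalyticAt ℝ arctan (τ (ρ • (c, d))) := contDiff_arctan.contDiffAt.analyticAt
    have hcomp {f : ℝ × ℝ → ℝ} (hf : AnalyticAt ℝ f (ρ • (c, d))) :
        AnalyticAt ℝ (fun p : ℝ × ℝ × ℝ => f (p.2.2 • (p.1, p.2.1))) (c, d, ρ) :=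
      hf.comp_of_eq hray rfl
    exact ⟨analyticAt_const.add (harctan.comp_of_eq (hcomp hτ) rfl), hcomp ha, hcomp hz⟩
  · have hscale {f : ℝ → ℝ} {n : ℕ} (hf : ∀ s ∈ Ioo (0 : ℝ) 1, |f (s * r)| ≤ C * s ^ n) :
        f =O[𝓝[>] 0] fun ρ => ρ ^ n := by
      refine IsBigO.of_bound (C / r ^ n) ?_
      filter_upwards [hIoo] with ρ hρ
      have := hf _ (hdiv hρ)
      rw [div_mul_cancel₀ _ hr.ne', div_pow] at this
      rw [norm_eq_abs, norm_of_nonneg (pow_nonneg hρ.1.le n)]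
      exact this.trans_eq (by ring)
    have hτ : (fun ρ => τ (ρ • (c, d)) - c * ρ) =O[𝓝[>] 0] fun ρ => ρ ^ 3 := by
      refine hscale fun s hs => ?_
      have := (hC s hs).1
      rw [smul_smul] at this
      convert this using 2
      simp
      ring
    refine ⟨?_, hscale fun s hs => ?_, hscale fun s hs => ?_⟩
    · have hτ1 : (fun ρ : ℝ => τ (ρ • (c, d))) =O[𝓝[>] 0] fun ρ => ρ := by
        have h3 : (fun ρ : ℝ => ρ ^ 3) =O[𝓝[>] 0] fun ρ => ρ :=
          ((isLittleO_pow_id (by norm_num)).isBigO).mono nhdsWithin_le_nhds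
        simpa using (hτ.trans h3).add ((isBigO_refl (fun ρ : ℝ => ρ) _).const_mul_left c)
      have hτ0 : Tendsto (fun ρ : ℝ => τ (ρ • (c, d))) (𝓝[>] 0) (𝓝 0) :=
        hτ1.trans_tendsto (tendsto_id.mono_left nhdsWithin_le_nhds)
      have := ((isBigO_arctan_sub_id.comp_tendsto hτ0).trans (hτ1.pow 3)).add hτ
      refine this.congr_left fun ρ => ?_
      simp only [Function.comp_apply]
      ring
    · have := (hC s hs).2.2
      rw [smul_smul] at this
      convert this using 2
      simp
      ring
    · have := (hC s hs).2.1
      rw [smul_smul] at this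
      convert this using 2
      simp
      ring
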